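/- Let X be a δ-hyperbolic geodesic space, ℓ a bi-infinite geodesic, K > 0, and f : [a,b] → X a continuous rectifiable path with d(f(t),ℓ) ≥ K for all t. Set x = f(a), y = f(b), d = d(x,y), K_x = d(x,ℓ), K_y = d(y,ℓ), L = length(f([a,b])), and assume L > 2δ and d = K_x + K_y + 6δ. Then L ≥ (2^{K/δ − 3} − 2)δ. -/

import Mathlib

open Metric Set

/-- `g` parametrizes a geodesic segment from `x` to `y` (unit speed on `[0, dist x y]`). -/
def IsGeodParam {X : Type*} [MetricSpace X] (g : ℝ → X) (x y : X) : Prop :=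
  g 0 = x ∧ g (dist x y) = y ∧
    ∀ s ∈ Set.Icc (0:ℝ) (dist x y), ∀ t ∈ Set.Icc (0:ℝ) (dist x y),
      dist (g s) (g t) = |s - t|

/-- The geodesic segment as a subset of `X`. -/
def segSet {X : Type*} [MetricSpace X] (g : ℝ → X) (x y : X) : Set X :=
  g '' Set.Icc 0 (dist x y)

/-- `X` is δ-hyperbolic: every geodesic triangle is δ-thin. -/
def DeltaThin (X : Type*) [MetricSpace X] (δ : ℝ) : Prop :=
  ∀ (x y z : X) (gxy gyz gxz : ℝ → X),
    IsGeodParam gxy x y → IsGeodParam gyz y z → IsGeodParam gxz x z →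
    ∀ p ∈ segSet gxy x y, ∃ q ∈ segSet gyz y z ∪ segSet gxz x z, dist p q ≤ δ

/-- `ℓ` is a bi-infinite geodesic (an isometric embedding of `ℝ`). -/
def IsGeodLine {X : Type*} [MetricSpace X] (ℓ : ℝ → X) : Prop :=
  ∀ s t : ℝ, dist (ℓ s) (ℓ t) = |s - t|

section GeodesicSegments

variable {X : Type*} [MetricSpace X]

/-- A geodesic segment can be traversed backwards. -/
theorem IsGeodParam.exists_reverse {g : ℝ → X} {x y : X} (hg : IsGeodParam g x y) :
    ∃ g' : ℝ → X, IsGeodParam g' y x ∧ segSet g' y x = segSet g x y := by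
  obtain ⟨h0, h1, hd⟩ := hg
  refine ⟨fun t => g (dist x y - t), ⟨by simpa using h1, by simpa [dist_comm y x] using h0, ?_⟩, ?_⟩
  · intro s hs t ht
    rw [dist_comm y x] at hs ht
    rw [hd _ ⟨by linarith [hs.2], by linarith [hs.1]⟩ _ ⟨by linarith [ht.2], by linarith [ht.1]⟩,
      abs_sub_comm]
    congr 1
    ring
  · unfold segSet
    rw [dist_comm y x]
    ext p
    constructor
    · rintro ⟨t, ht, rfl⟩
      exact ⟨dist x y - t, ⟨by linarith [ht.2], by linarith [ht.1]⟩, rfl⟩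
    · rintro ⟨t, ht, rfl⟩
      exact ⟨dist x y - t, ⟨by linarith [ht.2], by linarith [ht.1]⟩, by simp⟩

theorem IsGeodParam.dist_left {g : ℝ → X} {x y : X} (hg : IsGeodParam g x y) {t : ℝ}
    (ht : t ∈ Icc 0 (dist x y)) : dist x (g t) = t := by
  obtain ⟨h0, -, hd⟩ := hg
  rw [← h0, hd 0 ⟨le_rfl, ht.1.trans ht.2⟩ t ht, zero_sub, abs_neg, abs_of_nonneg ht.1]

theorem IsGeodParam.dist_right {g : ℝ → X} {x y : X} (hg : IsGeodParam g x y) {t : ℝ}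
    (ht : t ∈ Icc 0 (dist x y)) : dist (g t) y = dist x y - t := by
  obtain ⟨-, h1, hd⟩ := hg
  conv_lhs => rw [← h1]
  rw [hd t ht _ ⟨ht.1.trans ht.2, le_rfl⟩, abs_sub_comm, abs_of_nonneg (sub_nonneg.2 ht.2)]

/-- A point of a geodesic segment is no further from the initial point than the endpoint is. -/
theorem IsGeodParam.dist_left_le {g : ℝ → X} {x y q : X} (hg : IsGeodParam g x y)
    (hq : q ∈ segSet g x y) : dist x q ≤ dist x y := by
  obtain ⟨t, ht, rfl⟩ := hq
  exact (hg.dist_left ht).trans_le ht.2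

/-- Any two points of a bi-infinite geodesic are joined by a geodesic segment contained in it. -/
theorem IsGeodLine.exists_segment {ℓ : ℝ → X} (hℓ : IsGeodLine ℓ) (s t : ℝ) :
    ∃ g : ℝ → X, IsGeodParam g (ℓ s) (ℓ t) ∧ segSet g (ℓ s) (ℓ t) ⊆ range ℓ := by
  have forward : ∀ s t : ℝ, s ≤ t →
      ∃ g : ℝ → X, IsGeodParam g (ℓ s) (ℓ t) ∧ segSet g (ℓ s) (ℓ t) ⊆ range ℓ := by
    intro s t hst
    refine ⟨fun r => ℓ (s + r), ⟨by simp, ?_, fun u _ v _ => by rw [hℓ, add_sub_add_left_eq_sub]⟩, ?_⟩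
    · rw [hℓ, abs_sub_comm, abs_of_nonneg (sub_nonneg.2 hst)]
      simp
    · rintro _ ⟨r, -, rfl⟩
      exact mem_range_self _
  rcases le_total s t with hst | hts
  · exact forward s t hst
  · obtain ⟨g, hg, hsub⟩ := forward t s hts
    obtain ⟨g', hg', heq⟩ := hg.exists_reverse
    exact ⟨g', hg', heq ▸ hsub⟩

theorem IsGeodLine.isClosed_range {ℓ : ℝ → X} (hℓ : IsGeodLine ℓ) : IsClosed (range ℓ) :=
  (Isometry.of_dist_eq fun s t =>
    (hℓ s t).trans (Real.dist_eq s t).symm).isClosedEmbedding.isClosed_range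

/-- Geodesic quadrilaterals in a space with `δ`-thin triangles are `2δ`-thin. -/
theorem DeltaThin.quadrilateral {δ : ℝ} (hyp : DeltaThin X δ)
    (hgeo : ∀ p q : X, ∃ g : ℝ → X, IsGeodParam g p q) {x y x' y' p : X} {g g₁ g₂ g₃ : ℝ → X}
    (hδ : 0 ≤ δ) (hg : IsGeodParam g x y) (h₁ : IsGeodParam g₁ x x') (h₂ : IsGeodParam g₂ x' y')
    (h₃ : IsGeodParam g₃ y y') (hp : p ∈ segSet g x y) :
    ∃ q ∈ segSet g₁ x x' ∪ segSet g₂ x' y' ∪ segSet g₃ y y', dist p q ≤ 2 * δ := by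
  obtain ⟨e, he⟩ := hgeo y x'
  obtain ⟨r, hr | hr, hpr⟩ := hyp x y x' g e g₁ hg he h₁ p hp
  · obtain ⟨q, hq | hq, hrq⟩ := hyp y x' y' e g₂ g₃ he h₂ h₃ r hr
    · exact ⟨q, .inl (.inr hq), by linarith [dist_triangle p r q]⟩
    · exact ⟨q, .inr hq, by linarith [dist_triangle p r q]⟩
  · exact ⟨r, .inl (.inl hr), by linarith⟩

/-- If `x` and `y` are further apart than the sum of their distances to a bi-infinite geodesic
plus `4δ`, then any geodesic segment between them passes within `2δ` of that line. -/
theorem DeltaThin.exists_dist_range_le [ProperSpace X] {δ : ℝ} (hδ : 0 < δ) (hyp : DeltaThin X δ)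
    (hgeo : ∀ p q : X, ∃ g : ℝ → X, IsGeodParam g p q) {ℓ : ℝ → X} (hℓ : IsGeodLine ℓ)
    {x y : X} {g : ℝ → X} (hg : IsGeodParam g x y)
    (hd : infDist x (range ℓ) + infDist y (range ℓ) + 4 * δ < dist x y) :
    ∃ p ∈ segSet g x y, ∃ q ∈ range ℓ, dist p q ≤ 2 * δ := by
  obtain ⟨_, ⟨s, rfl⟩, hs⟩ := hℓ.isClosed_range.exists_infDist_eq_dist (range_nonempty ℓ) x
  obtain ⟨_, ⟨t, rfl⟩, ht⟩ := hℓ.isClosed_range.exists_infDist_eq_dist (range_nonempty ℓ) y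
  rw [hs, ht] at hd
  obtain ⟨g₁, h₁⟩ := hgeo x (ℓ s)
  obtain ⟨g₂, h₂, hsub⟩ := hℓ.exists_segment s t
  obtain ⟨g₃, h₃⟩ := hgeo y (ℓ t)
  set r := (dist x y + dist x (ℓ s) - dist y (ℓ t)) / 2 with hr
  have hrI : r ∈ Icc 0 (dist x y) := by
    have := dist_nonneg (x := x) (y := ℓ s)
    have := dist_nonneg (x := y) (y := ℓ t)
    constructor <;> linarith
  have hp : g r ∈ segSet g x y := mem_image_of_mem g hrI
  refine ⟨g r, hp, ?_⟩
  obtain ⟨q, (hq | hq) | hq, hpq⟩ := hyp.quadrilateral hgeo hδ.le hg h₁ h₂ h₃ hp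
  · linarith [h₁.dist_left_le hq, hg.dist_left hrI, dist_triangle x q (g r), dist_comm q (g r)]
  · exact ⟨q, hsub hq, hpq⟩
  · linarith [h₃.dist_left_le hq, hg.dist_right hrI, dist_triangle (g r) q y, dist_comm q y]

/-- A path of length at most `2 ^ (n + 1) * δ` comes within `(n + 1) * δ` of every point of a
geodesic segment between its endpoints. Here `V` plays the role of the arc length of `f`. -/
theorem DeltaThin.exists_dist_path_le {δ : ℝ} (hyp : DeltaThin X δ)
    (hgeo : ∀ p q : X, ∃ g : ℝ → X, IsGeodParam g p q) {f : ℝ → X} {V : ℝ → ℝ} (n : ℕ) :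
    ∀ {a b : ℝ}, a ≤ b → ContinuousOn V (Icc a b) →
      (∀ s ∈ Icc a b, ∀ t ∈ Icc a b, s ≤ t → dist (f s) (f t) ≤ V t - V s) →
      V b - V a ≤ 2 ^ (n + 1) * δ →
      ∀ {g : ℝ → X}, IsGeodParam g (f a) (f b) → ∀ p ∈ segSet g (f a) (f b),
        ∃ t ∈ Icc a b, dist p (f t) ≤ (n + 1) * δ := by
  induction n with
  | zero =>
    rintro a b hab - hV hlen g hg _ ⟨t, ht, rfl⟩
    have hle := hV a (left_mem_Icc.2 hab) b (right_mem_Icc.2 hab) hab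
    have hl := hg.dist_left ht
    have hr := hg.dist_right ht
    norm_num at hlen ⊢
    rcases le_total t δ with h | h
    · exact ⟨a, ⟨le_rfl, hab⟩, by rw [dist_comm]; linarith⟩
    · exact ⟨b, ⟨hab, le_rfl⟩, by linarith⟩
  | succ n ih =>
    intro a b hab hcont hV hlen g hg p hp
    have hle := dist_nonneg.trans (hV a (left_mem_Icc.2 hab) b (right_mem_Icc.2 hab) hab)
    obtain ⟨m, hm, hVm⟩ := intermediate_value_Icc hab hcont
      (show (V a + V b) / 2 ∈ Icc (V a) (V b) from ⟨by linarith, by linarith⟩)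
    have hleft : Icc a m ⊆ Icc a b := Icc_subset_Icc_right hm.2
    have hright : Icc m b ⊆ Icc a b := Icc_subset_Icc_left hm.1
    rw [pow_succ] at hlen
    obtain ⟨g₁, h₁⟩ := hgeo (f a) (f m)
    obtain ⟨g₂, h₂⟩ := hgeo (f m) (f b)
    obtain ⟨g₂', h₂', hseg⟩ := h₂.exists_reverse
    obtain ⟨q, hq, hpq⟩ := hyp _ _ _ g g₂' g₁ hg h₂' h₁ p hp
    obtain ⟨t, ht, hqt⟩ : ∃ t ∈ Icc a b, dist q (f t) ≤ (n + 1) * δ := by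
      rcases hq with hq | hq
      · obtain ⟨t, ht, h⟩ := ih hm.2 (hcont.mono hright)
          (fun s hs t ht => hV s (hright hs) t (hright ht)) (by linarith) h₂ q (hseg ▸ hq)
        exact ⟨t, hright ht, h⟩
      · obtain ⟨t, ht, h⟩ := ih hm.1 (hcont.mono hleft)
          (fun s hs t ht => hV s (hleft hs) t (hleft ht)) (by linarith) h₁ q hq
        exact ⟨t, hleft ht, h⟩
    refine ⟨t, ht, ?_⟩
    push_cast
    linarith [dist_triangle p q (f t)]

end GeodesicSegments

/-- The arc length of a continuous rectifiable path is continuous. -/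
theorem BoundedVariationOn.continuousOn_variationOnFromTo {E : Type*} [PseudoMetricSpace E]
    {f : ℝ → E} {s : Set ℝ} (hbv : BoundedVariationOn f s) (hf : ContinuousOn f s) {a : ℝ}
    (ha : a ∈ s) : ContinuousOn (variationOnFromTo f s a) s := by
  intro x hx
  have hl := hbv.tendsto_eVariationOn_Icc_zero_left ((hf x hx).mono inter_subset_left)
  have hr := hbv.tendsto_eVariationOn_Icc_zero_right x ((hf x hx).mono inter_subset_left)
  have h := ((ENNReal.tendsto_toReal ENNReal.zero_ne_top).comp hl).add
    ((ENNReal.tendsto_toReal ENNReal.zero_ne_top).comp hr)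
  simp only [ENNReal.toReal_zero, add_zero] at h
  refine tendsto_iff_dist_tendsto_zero.2 (squeeze_zero' (.of_forall fun _ => dist_nonneg) ?_ h)
  filter_upwards [self_mem_nhdsWithin] with y hy
  rw [Real.dist_eq, variationOnFromTo.sub_right hbv.locallyBoundedVariationOn ha hy hx]
  simp only [Function.comp_apply]
  have h1 := ENNReal.toReal_nonneg (a := eVariationOn f (s ∩ Icc x y))
  have h2 := ENNReal.toReal_nonneg (a := eVariationOn f (s ∩ Icc y x))
  rcases le_total x y with hxy | hyx
  · rw [variationOnFromTo.eq_of_le f s hxy, abs_of_nonneg h1]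
    linarith
  · rw [variationOnFromTo.eq_of_ge f s hyx, abs_neg, abs_of_nonneg h2]
    linarith

theorem BoundedVariationOn.dist_le_variationOnFromTo_sub {E : Type*} [PseudoMetricSpace E]
    {f : ℝ → E} {s : Set ℝ} (hbv : BoundedVariationOn f s) {a u v : ℝ} (ha : a ∈ s) (hu : u ∈ s)
    (hv : v ∈ s) (huv : u ≤ v) :
    dist (f u) (f v) ≤ variationOnFromTo f s a v - variationOnFromTo f s a u := by
  rw [variationOnFromTo.sub_right hbv.locallyBoundedVariationOn ha hv hu,
    variationOnFromTo.eq_of_le f s huv]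
  exact (hbv.mono inter_subset_left).dist_le ⟨hu, le_rfl, huv⟩ ⟨hv, huv, le_rfl⟩

/-- Let `f : [a,b] → X` be a continuous rectifiable path staying at distance `≥ K` from the
bi-infinite geodesic `ℓ`, with length `L > 2δ`. If
`d(f a, f b) = K_x + K_y + 6δ` then `L ≥ (2^{K/δ − 3} − 2)·δ`. -/
theorem stmt_8 {X : Type*} [MetricSpace X] [ProperSpace X] (δ : ℝ) (hδ : 0 < δ)
    (hyp : DeltaThin X δ)
    (hgeo : ∀ p q : X, ∃ g : ℝ → X, IsGeodParam g p q)
    (ℓ : ℝ → X) (hℓ : IsGeodLine ℓ) (K : ℝ) (hK : 0 < K)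
    (a b : ℝ) (hab : a ≤ b) (f : ℝ → X) (hf : ContinuousOn f (Set.Icc a b))
    (hrect : eVariationOn f (Set.Icc a b) ≠ ⊤)
    (hfar : ∀ t ∈ Set.Icc a b, K ≤ Metric.infDist (f t) (Set.range ℓ))
    (hL : 2 * δ < (eVariationOn f (Set.Icc a b)).toReal)
    (hd : dist (f a) (f b) =
        Metric.infDist (f a) (Set.range ℓ) + Metric.infDist (f b) (Set.range ℓ) + 6 * δ) :
    ((2 : ℝ) ^ (K / δ - 3) - 2) * δ ≤ (eVariationOn f (Set.Icc a b)).toReal := by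
  have hbv : BoundedVariationOn f (Icc a b) := hrect
  have ha : a ∈ Icc a b := left_mem_Icc.2 hab
  set L := (eVariationOn f (Icc a b)).toReal with hLdef
  have hlen : variationOnFromTo f (Icc a b) a b - variationOnFromTo f (Icc a b) a a = L := by
    rw [variationOnFromTo.self, variationOnFromTo.eq_of_le f _ hab, inter_self, sub_zero]
  obtain ⟨n, hn, hn'⟩ := exists_nat_pow_near (x := L / δ) (y := 2)
    (by rw [le_div_iff₀ hδ]; linarith) one_lt_two
  rw [le_div_iff₀ hδ] at hn
  rw [div_lt_iff₀ hδ] at hn'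
  obtain ⟨g, hg⟩ := hgeo (f a) (f b)
  obtain ⟨p, hp, q, hq, hpq⟩ := hyp.exists_dist_range_le hδ hgeo hℓ hg (by linarith)
  obtain ⟨t, ht, hpt⟩ := hyp.exists_dist_path_le hgeo n hab
    (hbv.continuousOn_variationOnFromTo hf ha)
    (fun s hs t ht => hbv.dist_le_variationOnFromTo_sub ha hs ht) (hlen.trans_le hn'.le) hg p hp
  have hK : K ≤ (n + 3) * δ := by
    linarith [hfar t ht, infDist_le_dist_of_mem (x := f t) hq, dist_triangle (f t) p q,
      dist_comm (f t) p]
  have hpow : (2 : ℝ) ^ (K / δ - 3) ≤ 2 ^ n := by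
    rw [← Real.rpow_natCast]
    refine Real.rpow_le_rpow_of_exponent_le one_le_two ?_
    linarith [(div_le_iff₀ hδ).2 hK]
  nlinarith [mul_le_mul_of_nonneg_right hpow hδ.le]
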